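/- Let d ≥ 2 be an integer and let f : ℝ^{d-1} × ℝ → ℝ be smooth with compact support contained in ℝ^{d-1} × (0,∞). Then for every k ∈ ℝ^{d-1} and θ ∈ (0, π/2), the Fourier transform of the unweighted conical Radon transform satisfies: (F R^(0) f)(k, θ) = ∫_0^∞ (s·sin(θ))^{d-2} · (F f)(k, s·cos(θ)) · (∫_{S^{d-2}} e^{i·s·sin(θ)·⟨k,n⟩} dn) ds. -/

import Mathlib

open MeasureTheory Real Metric
open scoped RealInnerProductSpace

noncomputable section

/-- The standard surface measure on the unit sphere `S^{d-2} ⊆ ℝ^{d-1}`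
(for `d = 2` this is the counting measure on `S^0 = {±1}`). -/
def sphereMeasure (d : ℕ) : Measure (sphere (0 : EuclideanSpace ℝ (Fin (d - 1))) 1) :=
  (volume : Measure (EuclideanSpace ℝ (Fin (d - 1)))).toSphere

/-- The conical Radon transform with radial weight `1/s^p`:
`(R^(p) f)(u, θ) = ∫_0^∞ s^(-p) ∫_{S^{d-2}} f(u + s sin θ n, s cos θ) (s sin θ)^(d-2) dn ds`. -/
def coneRadon (d : ℕ) (p : ℝ) (f : EuclideanSpace ℝ (Fin (d - 1)) × ℝ → ℝ)
    (u : EuclideanSpace ℝ (Fin (d - 1))) (θ : ℝ) : ℝ :=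
  ∫ s in Set.Ioi (0 : ℝ),
    s ^ (-p) *
      ∫ n, f (u + (s * Real.sin θ) • (n : EuclideanSpace ℝ (Fin (d - 1))), s * Real.cos θ) *
          (s * Real.sin θ) ^ (d - 2) ∂(sphereMeasure d)

/-- Fourier transform in the first argument:
`(F g)(k, θ) = ∫_{ℝ^{d-1}} e^{-i⟨k,u⟩} g(u, θ) du`. -/
def fourierFirst (d : ℕ) (g : EuclideanSpace ℝ (Fin (d - 1)) → ℝ → ℝ)
    (k : EuclideanSpace ℝ (Fin (d - 1))) (θ : ℝ) : ℂ :=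
  ∫ u, Complex.exp (-Complex.I * (⟪k, u⟫ : ℝ)) * (g u θ : ℂ)

/-- The Riesz-filtered data
`g(u, θ) = (2π)^(1-d) ∫_{ℝ^{d-1}} |k|^(d-1) (F R^(p) f)(k, θ) e^{i⟨k,u⟩} dk`. -/
def filteredData (d : ℕ) (p : ℝ) (f : EuclideanSpace ℝ (Fin (d - 1)) × ℝ → ℝ)
    (u : EuclideanSpace ℝ (Fin (d - 1))) (θ : ℝ) : ℂ :=
  (((2 * π) ^ ((1 : ℤ) - (d : ℤ)) : ℝ) : ℂ) *
    ∫ k, ((‖k‖ ^ (d - 1) : ℝ) : ℂ) * fourierFirst d (coneRadon d p f) k θ *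
      Complex.exp (Complex.I * (⟪k, u⟫ : ℝ))

/-- The integrand of the Fourier transform of the conical Radon transform, as a function of the
vertex `u` and of the polar coordinates `(s, n)` on the cone. -/
def coneIntegrand (d : ℕ) (f : EuclideanSpace ℝ (Fin (d - 1)) × ℝ → ℝ)
    (k : EuclideanSpace ℝ (Fin (d - 1))) (θ : ℝ) (u : EuclideanSpace ℝ (Fin (d - 1)))
    (q : ℝ × sphere (0 : EuclideanSpace ℝ (Fin (d - 1))) 1) : ℂ :=
  Complex.exp (-Complex.I * (⟪k, u⟫ : ℝ)) *
    ((f (u + (q.1 * Real.sin θ) • (q.2 : EuclideanSpace ℝ (Fin (d - 1))), q.1 * Real.cos θ) *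
      (q.1 * Real.sin θ) ^ (d - 2) : ℝ) : ℂ)

theorem integrable_coneIntegrand (d : ℕ) {f : EuclideanSpace ℝ (Fin (d - 1)) × ℝ → ℝ}
    (hf : Continuous f) (hfc : HasCompactSupport f) (k : EuclideanSpace ℝ (Fin (d - 1)))
    {θ : ℝ} (hθ : Real.cos θ ≠ 0) :
    Integrable (Function.uncurry (coneIntegrand d f k θ))
      (volume.prod ((volume.restrict (Set.Ioi (0 : ℝ))).prod (sphereMeasure d))) := by
  have : IsFiniteMeasure (sphereMeasure d) := by unfold sphereMeasure; infer_instance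
  refine Continuous.integrable_of_hasCompactSupport ?_ ?_
  · unfold coneIntegrand Function.uncurry
    fun_prop
  · let K := (fun x : (EuclideanSpace ℝ (Fin (d - 1)) × ℝ) ×
        sphere (0 : EuclideanSpace ℝ (Fin (d - 1))) 1 =>
      (x.1.1 - (x.1.2 / Real.cos θ * Real.sin θ) • (x.2 : EuclideanSpace ℝ (Fin (d - 1))),
        (x.1.2 / Real.cos θ, x.2))) '' (tsupport f ×ˢ Set.univ)
    have hK : IsCompact K :=
      (IsCompact.prod hfc isCompact_univ).image (by fun_prop)
    refine HasCompactSupport.intro hK ?_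
    rintro ⟨u, s, n⟩ hx
    have h : (u + (s * Real.sin θ) • (n : EuclideanSpace ℝ (Fin (d - 1))), s * Real.cos θ) ∉
        tsupport f := by
      refine fun h => hx ⟨⟨_, n⟩, ⟨h, Set.mem_univ _⟩, ?_⟩
      simp [hθ]
    simp [coneIntegrand, image_eq_zero_of_notMem_tsupport h]

theorem integral_coneIntegrand_vertex (d : ℕ) (f : EuclideanSpace ℝ (Fin (d - 1)) × ℝ → ℝ)
    (k : EuclideanSpace ℝ (Fin (d - 1))) (θ s : ℝ)
    (n : sphere (0 : EuclideanSpace ℝ (Fin (d - 1))) 1) :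
    ∫ u, coneIntegrand d f k θ u (s, n) =
      (((s * Real.sin θ) ^ (d - 2) : ℝ) : ℂ) *
        fourierFirst d (fun u y => f (u, y)) k (s * Real.cos θ) *
        Complex.exp (Complex.I *
          ((s * Real.sin θ) * ⟪k, (n : EuclideanSpace ℝ (Fin (d - 1)))⟫ : ℝ)) := by
  rw [fourierFirst, ← integral_add_right_eq_self
    (fun u => Complex.exp (-Complex.I * (⟪k, u⟫ : ℝ)) * (f (u, s * Real.cos θ) : ℂ))
    ((s * Real.sin θ) • (n : EuclideanSpace ℝ (Fin (d - 1)))), ← integral_const_mul,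
    ← integral_mul_const]
  refine integral_congr_ae (.of_forall fun u => ?_)
  have hexp : Complex.exp (-Complex.I * (⟪k, u⟫ : ℝ)) =
      Complex.exp (-Complex.I * (⟪k, u + (s * Real.sin θ) •
        (n : EuclideanSpace ℝ (Fin (d - 1)))⟫ : ℝ)) *
      Complex.exp (Complex.I *
        ((s * Real.sin θ) * ⟪k, (n : EuclideanSpace ℝ (Fin (d - 1)))⟫ : ℝ)) := by
    rw [← Complex.exp_add, inner_add_right, real_inner_smul_right]
    congr 1
    push_cast
    ring
  simp only [coneIntegrand]
  rw [hexp, Complex.ofReal_mul (f _)]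
  ring

/-- the Fourier transform (in the first argument) of the unweighted conical
Radon transform: `(F R^(0) f)(k, θ)
= ∫_0^∞ (s sin θ)^{d-2} (F f)(k, s cos θ) (∫_{S^{d-2}} e^{i s sin θ ⟨k,n⟩} dn) ds`. -/
theorem fourier_coneRadon_zero (d : ℕ) (hd : 2 ≤ d)
    (f : EuclideanSpace ℝ (Fin (d - 1)) × ℝ → ℝ)
    (hf : ContDiff ℝ (⊤ : ℕ∞) f) (hfc : HasCompactSupport f)
    (hfs : tsupport f ⊆ {q : EuclideanSpace ℝ (Fin (d - 1)) × ℝ | 0 < q.2})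
    (k : EuclideanSpace ℝ (Fin (d - 1))) (θ : ℝ) (hθ : θ ∈ Set.Ioo (0 : ℝ) (π / 2)) :
    fourierFirst d (coneRadon d 0 f) k θ =
      ∫ s in Set.Ioi (0 : ℝ),
        (((s * Real.sin θ) ^ (d - 2) : ℝ) : ℂ) *
          fourierFirst d (fun u y => f (u, y)) k (s * Real.cos θ) *
          ∫ n, Complex.exp (Complex.I *
              ((s * Real.sin θ) * ⟪k, (n : EuclideanSpace ℝ (Fin (d - 1)))⟫ : ℝ))
            ∂(sphereMeasure d) := by
  have hcos : Real.cos θ ≠ 0 :=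
    (Real.cos_pos_of_mem_Ioo ⟨by linarith [hθ.1, Real.pi_pos], hθ.2⟩).ne'
  have : IsFiniteMeasure (sphereMeasure d) := by unfold sphereMeasure; infer_instance
  have hint := integrable_coneIntegrand d hf.continuous hfc k hcos
  calc fourierFirst d (coneRadon d 0 f) k θ
      = ∫ u, ∫ q, coneIntegrand d f k θ u q
          ∂((volume.restrict (Set.Ioi (0 : ℝ))).prod (sphereMeasure d)) := by
        refine integral_congr_ae ?_
        filter_upwards [hint.prod_right_ae] with u hu
        change Integrable (coneIntegrand d f k θ u) _ at hu
        rw [integral_prod _ hu]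
        simp only [coneIntegrand, integral_const_mul, integral_complex_ofReal, coneRadon, neg_zero,
          Real.rpow_zero, one_mul]
    _ = ∫ q, (∫ u, coneIntegrand d f k θ u q)
          ∂((volume.restrict (Set.Ioi (0 : ℝ))).prod (sphereMeasure d)) :=
        integral_integral_swap hint
    _ = _ := by
        have hright := hint.integral_prod_right
        simp only [Function.uncurry_apply_pair] at hright
        rw [integral_prod _ hright]
        simp only [integral_coneIntegrand_vertex, integral_const_mul]
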